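/- Let S(α,β) = [[1, 0],[α−iβ, 1]] and R(θ) = [[e^{−iθ/2}, 0],[0, e^{iθ/2}]] for real θ, α, β. Then for all v ∈ ℝ⁴: (a) S(α,β)ᴴ X(v) S(α,β) = X(S̃(α,β)·v), where S̃(α,β) is the real 4×4 matrix [[1+ζ, α, β, −ζ],[α, 1, 0, −α],[β, 0, 1, −β],[ζ, α, β, 1−ζ]] with ζ = (α²+β²)/2 and coordinates ordered (t,x,y,z); and (b) R(θ)ᴴ X(v) R(θ) = X(R̃(θ)·v), where R̃(θ) is the rotation matrix [[1,0,0,0],[0, cos θ, −sin θ, 0],[0, sin θ, cos θ, 0],[0,0,0,1]]. (The covering map sends the massless little group in SL(2,ℂ) onto the ISO(2)-like subgroup of the Lorentz group.) -/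

import Mathlib

open Matrix Complex

/-- The Hermitian matrix `X(v)` associated with `v = (t,x,y,z) ∈ ℝ⁴`. -/
noncomputable def Xmat (v : Fin 4 → ℝ) : Matrix (Fin 2) (Fin 2) ℂ :=
  !![(v 0 : ℂ) + v 3, (v 1 : ℂ) + I * v 2;
     (v 1 : ℂ) - I * v 2, (v 0 : ℂ) - v 3]

/-- `S(α,β)` in the massless little group. -/
noncomputable def Smat (α β : ℝ) : Matrix (Fin 2) (Fin 2) ℂ :=
  !![1, 0; (α : ℂ) - I * β, 1]

/-- `R(θ)` in the massless little group. -/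
noncomputable def Rmat (θ : ℝ) : Matrix (Fin 2) (Fin 2) ℂ :=
  !![Complex.exp (-I * θ / 2), 0; 0, Complex.exp (I * θ / 2)]

/-- The `ISO(2)`-like Lorentz matrix `S̃(α,β)`, with `ζ = (α²+β²)/2`. -/
noncomputable def Stilde (α β : ℝ) : Matrix (Fin 4) (Fin 4) ℝ :=
  !![1 + (α ^ 2 + β ^ 2) / 2, α, β, -((α ^ 2 + β ^ 2) / 2);
     α, 1, 0, -α;
     β, 0, 1, -β;
     (α ^ 2 + β ^ 2) / 2, α, β, 1 - (α ^ 2 + β ^ 2) / 2]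

/-- The rotation Lorentz matrix `R̃(θ)`. -/
noncomputable def Rtilde (θ : ℝ) : Matrix (Fin 4) (Fin 4) ℝ :=
  !![1, 0, 0, 0;
     0, Real.cos θ, -Real.sin θ, 0;
     0, Real.sin θ, Real.cos θ, 0;
     0, 0, 0, 1]

/-- The covering map sends the massless little group in `SL(2,ℂ)` onto the
`ISO(2)`-like subgroup of the Lorentz group: `S(α,β)ᴴ X(v) S(α,β) = X(S̃(α,β)v)`
and `R(θ)ᴴ X(v) R(θ) = X(R̃(θ)v)`. -/
theorem massless_little_group_covers_ISO2 (α β θ : ℝ) :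
    (∀ v : Fin 4 → ℝ, (Smat α β)ᴴ * Xmat v * Smat α β = Xmat ((Stilde α β).mulVec v)) ∧
    (∀ v : Fin 4 → ℝ, (Rmat θ)ᴴ * Xmat v * Rmat θ = Xmat ((Rtilde θ).mulVec v)) := by
  constructor
  · intro v
    ext i j
    fin_cases i <;> fin_cases j <;>
      simp [Smat, Xmat, Stilde, Matrix.mul_apply, Matrix.mulVec, dotProduct,
        Fin.sum_univ_succ] <;>
      ring_nf <;> simp only [I_sq] <;> ring
  · intro v
    have hc : (Rmat θ)ᴴ = !![exp (I * θ / 2), 0; 0, exp (-I * θ / 2)] := by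
      ext i j
      fin_cases i <;> fin_cases j <;>
        simp [Rmat, Matrix.conjTranspose_apply, ← Complex.exp_conj, Complex.conj_ofNat]
    have hinv : exp (I * θ / 2) * exp (-I * θ / 2) = 1 := by
      rw [← Complex.exp_add, ← Complex.exp_zero]
      congr 1
      ring
    have hpos : exp (I * θ / 2) * exp (I * θ / 2) = cos θ + I * sin θ := by
      rw [← Complex.exp_add, mul_comm I (sin _), ← Complex.exp_mul_I]
      congr 1
      ring
    have hneg : exp (-I * θ / 2) * exp (-I * θ / 2) = cos θ - I * sin θ := by
      have h := Complex.exp_mul_I (-(θ : ℂ))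
      rw [Complex.cos_neg, Complex.sin_neg] at h
      rw [← Complex.exp_add, show -I * (θ : ℂ) / 2 + -I * θ / 2 = -θ * I by ring, h]
      ring
    rw [hc, Rmat]
    generalize exp (I * θ / 2) = p at *
    generalize exp (-I * θ / 2) = q at *
    ext i j
    fin_cases i <;> fin_cases j <;>
      simp [Xmat, Rtilde, Matrix.mul_apply, Matrix.mulVec, dotProduct, Fin.sum_univ_succ]
    · linear_combination ((v 0 : ℂ) + v 3) * hinv
    · linear_combination ((v 1 : ℂ) + I * v 2) * hpos + sin θ * v 2 * I_sq
    · linear_combination ((v 1 : ℂ) - I * v 2) * hneg + sin θ * v 2 * I_sq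
    · linear_combination ((v 0 : ℂ) - v 3) * hinv
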